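/- Let d ≥ 2 and let real parameters λ^(k)_M (k ∈ {1,2}, M ⊆ {1,…,d}, |M| ≥ 2) satisfy the constraint ∑_{j=2}^d [ (√3)^j ∑_{|M|=j} |λ^(1)_M| + (√5)^j ∑_{|M|=j} |λ^(2)_M| ] ≤ 1. Then for every (u₁,…,u_d) ∈ [0,1]^d, the integral of the extended FGM density c over the box ∏_{j=1}^d [0, u_j] equals C(u₁,…,u_d) = ∏_{j=1}^d u_j + ∑_{k=1}^2 ∑_{j=2}^d ∑_{M ⊆ {1,…,d}, |M| = j} λ^(k)_M ∏_{m ∉ M} u_m ∏_{m ∈ M} Φ_k(u_m). In particular C(1,…,1) = 1, so c is a probability density on [0,1]^d. -/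

import Mathlib

open MeasureTheory ProbabilityTheory Real Finset

/-- The shifted Legendre-type functions: `φ₁(x) = √3 (2x − 1)` and
`φ₂(x) = √5 (6x² − 6x + 1)`. -/
noncomputable def phiFGM (k : ℕ) (x : ℝ) : ℝ :=
  if k = 1 then Real.sqrt 3 * (2 * x - 1) else Real.sqrt 5 * (6 * x ^ 2 - 6 * x + 1)

/-- Antiderivatives: `Φ₁(x) = √3 (x² − x)` and `Φ₂(x) = √5 (2x³ − 3x² + x)`. -/
noncomputable def PhiFGM (k : ℕ) (x : ℝ) : ℝ :=
  if k = 1 then Real.sqrt 3 * (x ^ 2 - x) else Real.sqrt 5 * (2 * x ^ 3 - 3 * x ^ 2 + x)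

/-- The density of the extended `d`-variate FGM copula with parameters `lam k M`:
`c(u) = 1 + ∑_{k=1}^2 ∑_{M ⊆ {1,…,d}, |M| ≥ 2} λ^(k)_M ∏_{m ∈ M} φ_k(u_m)`. -/
noncomputable def fgmDensity (d : ℕ) (lam : ℕ → Finset (Fin d) → ℝ) (u : Fin d → ℝ) : ℝ :=
  1 + ∑ k ∈ Finset.Icc 1 2, ∑ M ∈ Finset.univ.powerset.filter (fun M : Finset (Fin d) => 2 ≤ M.card),
      lam k M * ∏ m ∈ M, phiFGM k (u m)

/-- The admissibility constraint
`∑_{j=2}^d [ (√3)^j ∑_{|M|=j} |λ^(1)_M| + (√5)^j ∑_{|M|=j} |λ^(2)_M| ] ≤ 1`. -/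
def fgmAdmissible (d : ℕ) (lam : ℕ → Finset (Fin d) → ℝ) : Prop :=
  ∑ M ∈ Finset.univ.powerset.filter (fun M : Finset (Fin d) => 2 ≤ M.card),
      (Real.sqrt 3 ^ M.card * |lam 1 M| + Real.sqrt 5 ^ M.card * |lam 2 M|) ≤ 1

/-- The distribution function of the extended `d`-variate FGM copula:
`C(u) = ∏_j u_j + ∑_{k=1}^2 ∑_{M, |M| ≥ 2} λ^(k)_M ∏_{m ∉ M} u_m ∏_{m ∈ M} Φ_k(u_m)`. -/
noncomputable def fgmCDF (d : ℕ) (lam : ℕ → Finset (Fin d) → ℝ) (u : Fin d → ℝ) : ℝ :=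
  (∏ j, u j) + ∑ k ∈ Finset.Icc 1 2,
    ∑ M ∈ Finset.univ.powerset.filter (fun M : Finset (Fin d) => 2 ≤ M.card),
      lam k M * ((∏ m ∈ Mᶜ, u m) * ∏ m ∈ M, PhiFGM k (u m))

theorem continuous_phiFGM (k : ℕ) : Continuous (phiFGM k) := by
  unfold phiFGM
  split_ifs <;> fun_prop

theorem hasDerivAt_PhiFGM (k : ℕ) (x : ℝ) : HasDerivAt (PhiFGM k) (phiFGM k x) x := by
  unfold PhiFGM phiFGM
  split_ifs
  · refine (((hasDerivAt_pow 2 x).sub (hasDerivAt_id x)).const_mul (√3)).congr_deriv ?_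
    norm_num
  · refine (((((hasDerivAt_pow 3 x).const_mul 2).sub
      ((hasDerivAt_pow 2 x).const_mul 3)).add (hasDerivAt_id x)).const_mul (√5)).congr_deriv ?_
    norm_num
    ring

theorem PhiFGM_zero (k : ℕ) : PhiFGM k 0 = 0 := by simp [PhiFGM]

theorem PhiFGM_one (k : ℕ) : PhiFGM k 1 = 0 := by
  unfold PhiFGM
  split_ifs <;> norm_num

theorem setIntegral_Icc_phiFGM (k : ℕ) {a : ℝ} (ha : 0 ≤ a) :
    ∫ x in Set.Icc 0 a, phiFGM k x = PhiFGM k a := by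
  rw [integral_Icc_eq_integral_Ioc, ← intervalIntegral.integral_of_le ha,
    intervalIntegral.integral_eq_sub_of_hasDerivAt (fun x _ => hasDerivAt_PhiFGM k x)
      ((continuous_phiFGM k).intervalIntegrable _ _), PhiFGM_zero, sub_zero]

theorem setIntegral_pi_prod {ι : Type*} [Fintype ι] (s : ι → Set ℝ) (f : ι → ℝ → ℝ) :
    ∫ v in Set.pi Set.univ s, ∏ j, f j (v j) = ∏ j, ∫ x in s j, f j x := by
  rw [volume_pi, Measure.restrict_pi_pi]
  exact integral_fintype_prod_eq_prod f

theorem setIntegral_box_prod_phiFGM {ι : Type*} [Fintype ι] [DecidableEq ι] (k : ℕ)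
    (M : Finset ι) {u : ι → ℝ} (hu : ∀ j, 0 ≤ u j) :
    ∫ v in Set.pi Set.univ (fun j => Set.Icc (0:ℝ) (u j)), ∏ m ∈ M, phiFGM k (v m) =
      (∏ m ∈ Mᶜ, u m) * ∏ m ∈ M, PhiFGM k (u m) := by
  have h : ∀ v : ι → ℝ, ∏ m ∈ M, phiFGM k (v m) =
      ∏ j, (if j ∈ M then phiFGM k else fun _ => 1) (v j) := fun v => by
    simp only [ite_apply, Finset.prod_ite_mem, Finset.univ_inter]
  simp_rw [h]
  rw [setIntegral_pi_prod, ← Finset.prod_compl_mul_prod M]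
  congr 1
  · refine Finset.prod_congr rfl fun j hj => ?_
    rw [if_neg (Finset.mem_compl.mp hj)]
    simp [hu j]
  · refine Finset.prod_congr rfl fun j hj => ?_
    rw [if_pos hj, setIntegral_Icc_phiFGM k (hu j)]

theorem setIntegral_box_fgmDensity (d : ℕ) (lam : ℕ → Finset (Fin d) → ℝ) {u : Fin d → ℝ}
    (hu : ∀ j, 0 ≤ u j) :
    ∫ v in Set.pi Set.univ (fun j => Set.Icc (0:ℝ) (u j)), fgmDensity d lam v =
      fgmCDF d lam u := by
  have hint : ∀ f : (Fin d → ℝ) → ℝ, Continuous f →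
      IntegrableOn f (Set.pi Set.univ fun j => Set.Icc (0:ℝ) (u j)) := fun f hf =>
    hf.continuousOn.integrableOn_compact (isCompact_univ_pi fun _ => isCompact_Icc)
  have hterm : ∀ (k : ℕ) (M : Finset (Fin d)),
      Continuous fun v : Fin d → ℝ => lam k M * ∏ m ∈ M, phiFGM k (v m) := fun k M =>
    continuous_const.mul (continuous_finsetProd _ fun m _ =>
      (continuous_phiFGM k).comp (continuous_apply m))
  have hone : ∫ _ in Set.pi Set.univ (fun j => Set.Icc (0:ℝ) (u j)), (1:ℝ) = ∏ j, u j := by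
    simpa using setIntegral_box_prod_phiFGM 1 ∅ hu
  unfold fgmDensity fgmCDF
  rw [integral_add (hint _ continuous_const) (hint _ (continuous_finsetSum _ fun k _ =>
    continuous_finsetSum _ fun M _ => hterm k M)), hone, integral_finsetSum _ fun k _ =>
    hint _ (continuous_finsetSum _ fun M _ => hterm k M)]
  congr 1
  refine Finset.sum_congr rfl fun k _ => ?_
  rw [integral_finsetSum _ fun M _ => hint _ (hterm k M)]
  refine Finset.sum_congr rfl fun M _ => ?_
  rw [integral_const_mul, setIntegral_box_prod_phiFGM k M hu]

theorem fgmCDF_one (d : ℕ) (lam : ℕ → Finset (Fin d) → ℝ) : fgmCDF d lam (fun _ => 1) = 1 := by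
  unfold fgmCDF
  rw [Finset.sum_eq_zero, Finset.prod_const_one, add_zero]
  refine fun k _ => Finset.sum_eq_zero fun M hM => ?_
  have hcard : M.card ≠ 0 := by
    have := (Finset.mem_filter.mp hM).2
    lia
  simp only [PhiFGM_one, Finset.prod_const, zero_pow hcard, mul_zero]

theorem stmt_3 (d : ℕ) (hd : 2 ≤ d) (lam : ℕ → Finset (Fin d) → ℝ)
    (hlam : fgmAdmissible d lam) :
    (∀ u : Fin d → ℝ, (∀ j, u j ∈ Set.Icc (0:ℝ) 1) →
      ∫ v in Set.pi Set.univ (fun j => Set.Icc (0:ℝ) (u j)), fgmDensity d lam v =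
        fgmCDF d lam u) ∧
    fgmCDF d lam (fun _ => 1) = 1 := by
  exact ⟨fun u hu => setIntegral_box_fgmDensity d lam fun j => (hu j).1, fgmCDF_one d lam⟩
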